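/- Uniqueness: Let f, g : [m,M] → ℝ be bounded continuous functions which are both viscosity subsolutions and viscosity supersolutions of the HJB equation min{ δ f(r) − A(f)(r) − G(r), f(r) − (M f)(r) } = 0 on [m,M]. If f(m) = g(m) and f(M) = g(M), then f(r) = g(r) for all r ∈ [m,M]. -/

import Mathlib

open MeasureTheory Set

/-- Intervention operator
`(M u)(r) = sup_{0 ≤ ζ ≤ M - r} ( u(r+ζ) - H(r+ζ) + H(r) - k )`. -/
noncomputable def Mop (M k : ℝ) (H u : ℝ → ℝ) (r : ℝ) : ℝ :=
  sSup ((fun ζ : ℝ => u (r + ζ) - H (r + ζ) + H r - k) '' Icc 0 (M - r))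

/-- Integro-differential operator
`A(φ,u)(r) = -c(r) φ'(r) + λ ( ∫_{[0, r-m]} u(r-s) dμ(s) - u(r) )`. -/
noncomputable def Aop (m lam : ℝ) (c : ℝ → ℝ) (μ : Measure ℝ)
    (φ u : ℝ → ℝ) (r : ℝ) : ℝ :=
  -c r * deriv φ r + lam * ((∫ s in Icc 0 (r - m), u (r - s) ∂μ) - u r)

/-- `u` is a viscosity subsolution of the HJB equation
`min { δ f - A(f) - G , f - M f } = 0` on `[m, M]`. -/
def IsViscositySubsolution (m M lam δ k : ℝ) (c : ℝ → ℝ) (μ : Measure ℝ)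
    (G H : ℝ → ℝ) (u : ℝ → ℝ) : Prop :=
  ∀ φ : ℝ → ℝ, ContDiff ℝ 1 φ →
    ∀ r ∈ Ioo m M, (∀ z ∈ Icc m M, u z - φ z ≤ u r - φ r) → u r = φ r →
      min (δ * φ r - Aop m lam c μ φ u r - G r) (u r - Mop M k H u r) ≤ 0

/-- `v` is a viscosity supersolution of the HJB equation
`min { δ f - A(f) - G , f - M f } = 0` on `[m, M]`. -/
def IsViscositySupersolution (m M lam δ k : ℝ) (c : ℝ → ℝ) (μ : Measure ℝ)
    (G H : ℝ → ℝ) (v : ℝ → ℝ) : Prop :=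
  ∀ φ : ℝ → ℝ, ContDiff ℝ 1 φ →
    ∀ r ∈ Ioo m M, (∀ z ∈ Icc m M, v r - φ r ≤ v z - φ z) → v r = φ r →
      0 ≤ min (δ * φ r - Aop m lam c μ φ v r - G r) (v r - Mop M k H v r)

/-- If `u - v ≤ S` on `[m, M]` and `u`, `v` oscillate by at most `κ` at distance `|x - y|`, the
nonlocal terms differ by at most `S + κ`, provided `x` and `y` are ordered according to the sign of
the common boundary value `u m = v m`. -/
lemma setIntegral_sub_setIntegral_le {m M x y κ S : ℝ} {u v : ℝ → ℝ}
    (μ : Measure ℝ) [IsProbabilityMeasure μ]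
    (hu : ContinuousOn u (Icc m M)) (hv : ContinuousOn v (Icc m M))
    (hx : x ∈ Icc m M) (hy : y ∈ Icc m M) (hκ : 0 ≤ κ) (hS0 : 0 ≤ S)
    (hS : ∀ r ∈ Icc m M, u r - v r ≤ S)
    (hou : ∀ a ∈ Icc m M, ∀ b ∈ Icc m M, |a - b| ≤ |x - y| → |u a - u b| ≤ κ)
    (hov : ∀ a ∈ Icc m M, ∀ b ∈ Icc m M, |a - b| ≤ |x - y| → |v a - v b| ≤ κ)
    (hm : u m = v m) (hsign : (x ≤ y ∧ 0 ≤ u m) ∨ (y ≤ x ∧ u m ≤ 0)) :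
    (∫ s in Icc 0 (x - m), u (x - s) ∂μ) - (∫ s in Icc 0 (y - m), v (y - s) ∂μ) ≤ S + κ := by
  have integrable_shift : ∀ {w : ℝ → ℝ} {z : ℝ}, ContinuousOn w (Icc m M) → z ∈ Icc m M →
      Integrable ((Icc 0 (z - m)).indicator fun s => w (z - s)) μ := by
    intro w z hw hz
    rw [integrable_indicator_iff measurableSet_Icc]
    refine ContinuousOn.integrableOn_compact isCompact_Icc (hw.comp (by fun_prop) ?_)
    intro s hs
    exact ⟨by linarith [hs.2], by linarith [hs.1, hz.2]⟩
  rw [← integral_indicator measurableSet_Icc, ← integral_indicator measurableSet_Icc,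
    ← integral_sub (integrable_shift hu hx) (integrable_shift hv hy)]
  have hmm : m ∈ Icc m M := ⟨le_rfl, hx.1.trans hx.2⟩
  calc _ ≤ ∫ _, (S + κ) ∂μ := by
        refine integral_mono ((integrable_shift hu hx).sub (integrable_shift hv hy))
          (integrable_const _) fun s => ?_
        by_cases hsx : s ∈ Icc 0 (x - m) <;> by_cases hsy : s ∈ Icc 0 (y - m)
        · simp only [indicator_of_mem hsx, indicator_of_mem hsy]
          have hxs : x - s ∈ Icc m M := ⟨by linarith [hsx.2], by linarith [hsx.1, hx.2]⟩
          have hys : y - s ∈ Icc m M := ⟨by linarith [hsy.2], by linarith [hsy.1, hy.2]⟩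
          have h := abs_le.1 (hov _ hxs _ hys (by rw [sub_sub_sub_cancel_right]))
          linarith [hS _ hxs, h.2]
        · simp only [indicator_of_mem hsx, indicator_of_notMem hsy]
          have hxs : x - s ∈ Icc m M := ⟨by linarith [hsx.2], by linarith [hsx.1, hx.2]⟩
          have hlt : y - m < s := by
            by_contra h
            exact hsy ⟨hsx.1, not_lt.1 h⟩
          rcases hsign with ⟨h, _⟩ | ⟨h, h0⟩
          · linarith [hsx.2]
          · have h' := abs_le.1 (hou _ hxs _ hmm (by
              rw [abs_of_nonneg (by linarith [hsx.2]), abs_of_nonneg (by linarith)]; linarith))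
            linarith [h'.2]
        · simp only [indicator_of_notMem hsx, indicator_of_mem hsy]
          have hys : y - s ∈ Icc m M := ⟨by linarith [hsy.2], by linarith [hsy.1, hy.2]⟩
          have hlt : x - m < s := by
            by_contra h
            exact hsx ⟨hsy.1, not_lt.1 h⟩
          rcases hsign with ⟨h, h0⟩ | ⟨h, _⟩
          · have h' := abs_le.1 (hov _ hys _ hmm (by
              rw [abs_of_nonneg (by linarith [hsy.2]), abs_of_nonpos (by linarith)]; linarith))
            linarith [h'.1]
          · linarith [hsy.2]
        · simp only [indicator_of_notMem hsx, indicator_of_notMem hsy]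
          linarith
    _ = S + κ := by simp

lemma continuousOn_intervention {m M k x : ℝ} {H u : ℝ → ℝ} (hu : ContinuousOn u (Icc m M))
    (hH : ContinuousOn H (Icc m M)) (hx : x ∈ Icc m M) :
    ContinuousOn (fun ζ : ℝ => u (x + ζ) - H (x + ζ) + H x - k) (Icc 0 (M - x)) := by
  have hmaps : MapsTo (fun ζ : ℝ => x + ζ) (Icc 0 (M - x)) (Icc m M) := fun ζ hζ =>
    ⟨by linarith [hζ.1, hx.1], by linarith [hζ.2]⟩
  have hadd : ContinuousOn (fun ζ : ℝ => x + ζ) (Icc 0 (M - x)) := by fun_prop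
  exact (((hu.comp hadd hmaps).sub (hH.comp hadd hmaps)).add continuousOn_const).sub
    continuousOn_const

/-- The supremum defining the intervention operator is attained for continuous data. -/
lemma exists_Mop_eq {m M k x : ℝ} {H u : ℝ → ℝ} (hu : ContinuousOn u (Icc m M))
    (hH : ContinuousOn H (Icc m M)) (hx : x ∈ Icc m M) :
    ∃ z ∈ Icc x M, Mop M k H u x = u z - H z + H x - k := by
  obtain ⟨ζ, hζ, h⟩ := (isCompact_Icc.image_of_continuousOn
    (continuousOn_intervention (k := k) hu hH hx)).sSup_mem
      ((nonempty_Icc.2 (sub_nonneg.2 hx.2)).image _)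
  exact ⟨x + ζ, ⟨by linarith [hζ.1], by linarith [hζ.2]⟩, h.symm⟩

lemma le_Mop {m M k y z : ℝ} {H v : ℝ → ℝ} (hv : ContinuousOn v (Icc m M))
    (hH : ContinuousOn H (Icc m M)) (hy : y ∈ Icc m M) (hz : z ∈ Icc y M) :
    v z - H z + H y - k ≤ Mop M k H v y := by
  refine le_csSup (isCompact_Icc.image_of_continuousOn
    (continuousOn_intervention (k := k) hv hH hy)).bddAbove
      ⟨z - y, ⟨by linarith [hz.1], by linarith [hz.2]⟩, ?_⟩
  simp

lemma ContinuousOn.exists_dist_modulus {m M κ : ℝ} {u : ℝ → ℝ}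
    (hu : ContinuousOn u (Icc m M)) (hκ : 0 < κ) :
    ∃ d > 0, ∀ a ∈ Icc m M, ∀ b ∈ Icc m M, |a - b| < d → |u a - u b| < κ := by
  simpa only [Real.dist_eq] using Metric.uniformContinuousOn_iff.1
    (isCompact_Icc.uniformContinuousOn_of_continuous hu) κ hκ

/-- Doubling of variables with a shifted penalization `((x - y) / ε - σ) ^ 2`, which forces
`x - y` to have the sign of `σ`. -/
lemma exists_doubling_max {m M η κ d σ r : ℝ} {u v : ℝ → ℝ}
    (hu : ContinuousOn u (Icc m M)) (hv : ContinuousOn v (Icc m M))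
    (hr : r ∈ Ioo m M) (hrmax : ∀ z ∈ Icc m M, u z - v z + η * z ≤ u r - v r + η * r)
    (hσ : |σ| = 1) (hd : 0 < d)
    (hov : ∀ a ∈ Icc m M, ∀ b ∈ Icc m M, |a - b| < d → |v a - v b| < κ) :
    ∃ ε > 0, ∃ x ∈ Icc m M, ∃ y ∈ Icc m M,
      (∀ a ∈ Icc m M, ∀ b ∈ Icc m M,
        u a - v b + η * a - ((a - b) / ε - σ) ^ 2 ≤ u x - v y + η * x - ((x - y) / ε - σ) ^ 2) ∧
      |x - y| < d ∧ u r - v r + η * r - κ ≤ u x - v y + η * x ∧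
      ((x - y) / ε - σ) ^ 2 ≤ 2 * κ := by
  have hrI : r ∈ Icc m M := Ioo_subset_Icc_self hr
  obtain ⟨B, hB⟩ : ∃ B, ∀ p ∈ Icc m M ×ˢ Icc m M, u p.1 - v p.2 + η * p.1 ≤ B := by
    have hc : ContinuousOn (fun p : ℝ × ℝ => u p.1 - v p.2 + η * p.1) (Icc m M ×ˢ Icc m M) :=
      ((hu.comp continuousOn_fst fun p hp => hp.1).sub
        (hv.comp continuousOn_snd fun p hp => hp.2)).add (by fun_prop)
    obtain ⟨B, hB⟩ := ((isCompact_Icc.prod isCompact_Icc).image_of_continuousOn hc).bddAbove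
    exact ⟨B, fun p hp => hB ⟨p, hp, rfl⟩⟩
  set K : ℝ := |B - (u r - v r + η * r - κ)| with hK
  have hK0 : 0 ≤ K := abs_nonneg _
  obtain ⟨ε, hε, hεd, hεm, hεM⟩ : ∃ ε > 0, ε * (K + 2) < d ∧ ε < r - m ∧ ε < M - r := by
    refine ⟨min (d / (K + 2)) (min (r - m) (M - r)) / 2, ?_, ?_, ?_, ?_⟩
    · have := sub_pos.2 hr.1
      have := sub_pos.2 hr.2
      positivity
    · have h := min_le_left (d / (K + 2)) (min (r - m) (M - r))
      rw [le_div_iff₀ (by linarith)] at h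
      linarith
    · have h := (min_le_right (d / (K + 2)) (min (r - m) (M - r))).trans (min_le_left _ _)
      linarith [hr.1]
    · have h := (min_le_right (d / (K + 2)) (min (r - m) (M - r))).trans (min_le_right _ _)
      linarith [hr.2]
  have hcont : ContinuousOn
      (fun p : ℝ × ℝ => u p.1 - v p.2 + η * p.1 - ((p.1 - p.2) / ε - σ) ^ 2)
      (Icc m M ×ˢ Icc m M) :=
    (((hu.comp continuousOn_fst fun p hp => hp.1).sub
      (hv.comp continuousOn_snd fun p hp => hp.2)).add (by fun_prop)).sub (by fun_prop)
  obtain ⟨⟨x, y⟩, ⟨hx, hy⟩, hmax⟩ :=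
    (isCompact_Icc.prod isCompact_Icc).exists_isMaxOn ⟨(r, r), hrI, hrI⟩ hcont
  have hmax' : ∀ a ∈ Icc m M, ∀ b ∈ Icc m M,
      u a - v b + η * a - ((a - b) / ε - σ) ^ 2 ≤
        u x - v y + η * x - ((x - y) / ε - σ) ^ 2 :=
    fun a ha b hb => hmax (show (a, b) ∈ Icc m M ×ˢ Icc m M from ⟨ha, hb⟩)
  have hσε : |σ * ε| = ε := by rw [abs_mul, hσ, one_mul, abs_of_pos hε]
  have hσε' := abs_le.1 hσε.le
  have hr' : r - σ * ε ∈ Icc m M := ⟨by linarith [hσε'.2], by linarith [hσε'.1]⟩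
  have hlow : u r - v r + η * r - κ ≤ u x - v y + η * x - ((x - y) / ε - σ) ^ 2 := by
    have h := hmax' r hrI _ hr'
    have h0 : (r - (r - σ * ε)) / ε - σ = 0 := by field_simp; ring
    rw [h0] at h
    have h1 := abs_lt.1 (hov r hrI _ hr' (by
      rw [sub_sub_cancel, hσε]; nlinarith))
    linarith [h1.1]
  have hsq := sq_nonneg ((x - y) / ε - σ)
  have hxy : |x - y| < d := by
    have h1 : ((x - y) / ε - σ) ^ 2 ≤ K := by
      have := hB (x, y) ⟨hx, hy⟩
      have := le_abs_self (B - (u r - v r + η * r - κ))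
      simp only at *
      linarith
    have h2 : |(x - y) / ε - σ| ≤ K + 1 := by
      rw [← sq_abs] at h1
      nlinarith [abs_nonneg ((x - y) / ε - σ)]
    have h3 : x - y = ε * (((x - y) / ε - σ) + σ) := by field_simp; ring
    calc |x - y| = ε * |((x - y) / ε - σ) + σ| := by
          conv_lhs => rw [h3]
          rw [abs_mul, abs_of_pos hε]
      _ ≤ ε * (K + 2) := by
          gcongr
          exact (abs_add_le _ _).trans (by linarith)
      _ < d := hεd
  refine ⟨ε, hε, x, hx, y, hy, hmax', hxy, by linarith, ?_⟩
  have h1 := abs_lt.1 (hov x hx y hy hxy)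
  linarith [hrmax x hx, h1.2]

set_option maxHeartbeats 1000000 in
/-- Comparison between a continuous subsolution and a continuous supersolution with equal boundary
values. -/
lemma viscosity_comparison {m M lam δ k : ℝ} (hlam : 0 < lam) (hδ : 0 < δ) (hk : 0 < k)
    {L : NNReal} {c : ℝ → ℝ} (hc_lip : LipschitzOnWith L c (Icc m M))
    (μ : Measure ℝ) [IsProbabilityMeasure μ] {G H : ℝ → ℝ}
    (hG : ContinuousOn G (Icc m M)) (hH : ContinuousOn H (Icc m M)) {u v : ℝ → ℝ}
    (hu : ContinuousOn u (Icc m M)) (hv : ContinuousOn v (Icc m M))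
    (hsub : IsViscositySubsolution m M lam δ k c μ G H u)
    (hsup : IsViscositySupersolution m M lam δ k c μ G H v)
    (hbm : u m = v m) (hbM : u M = v M) :
    ∀ r ∈ Icc m M, u r ≤ v r := by
  by_contra! hcon
  obtain ⟨q, hq, hqlt⟩ := hcon
  have hmM : m ≤ M := hq.1.trans hq.2
  obtain ⟨r₀, hr₀, hr₀max⟩ := isCompact_Icc.exists_isMaxOn ⟨q, hq⟩ (hu.sub hv)
  set S : ℝ := u r₀ - v r₀ with hSdef
  have hS : ∀ z ∈ Icc m M, u z - v z ≤ S := fun z hz => hr₀max hz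
  have hSpos : 0 < S := (sub_pos.2 hqlt).trans_le (hS q hq)
  obtain ⟨C, hC⟩ := (isCompact_Icc.image_of_continuousOn hc_lip.continuousOn).bddAbove
  have hcC : ∀ z ∈ Icc m M, c z ≤ |C| := fun z hz => (hC ⟨z, hz, rfl⟩).trans (le_abs_self C)
  obtain ⟨η, hη, hηS, hηδ⟩ : ∃ η > 0, η * (M - m) ≤ S / 2 ∧
      ((δ + lam) * (M - m) + |C|) * η ≤ δ * S / 2 := by
    have h0 : 0 ≤ M - m := sub_nonneg.2 hmM
    have hA : 0 ≤ (δ + lam) * (M - m) + |C| := by positivity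
    obtain ⟨η, hη, h⟩ := exists_pos_mul_lt (show 0 < min (S / 2) (δ * S / 2) by positivity)
      (M - m + ((δ + lam) * (M - m) + |C|))
    have := mul_nonneg h0 hη.le
    have := mul_nonneg hA hη.le
    exact ⟨η, hη, by linarith [h.trans_le (min_le_left _ _)],
      by linarith [h.trans_le (min_le_right _ _)]⟩
  obtain ⟨r, hrI, hrmax'⟩ := isCompact_Icc.exists_isMaxOn ⟨q, hq⟩
    ((hu.sub hv).add (continuousOn_const.mul continuousOn_id : ContinuousOn (fun z => η * z) _))
  have hrmax : ∀ z ∈ Icc m M, u z - v z + η * z ≤ u r - v r + η * r := fun z hz => hrmax' hz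
  have hW : S + η * m ≤ u r - v r + η * r := by
    have := hrmax r₀ hr₀
    have := mul_le_mul_of_nonneg_left hr₀.1 hη.le
    linarith
  have hηM : ∀ z ∈ Icc m M, η * z ≤ η * m + S / 2 := fun z hz => by
    have := mul_le_mul_of_nonneg_left hz.2 hη.le
    linarith
  have hr : r ∈ Ioo m M := by
    refine ⟨lt_of_le_of_ne hrI.1 fun h => ?_, lt_of_le_of_ne hrI.2 fun h => ?_⟩
    · have := hηM r hrI
      rw [← h] at this hW
      linarith
    · have := hηM r hrI
      rw [h] at this hW
      linarith
  obtain ⟨d₁, hd₁, hud₁⟩ := hu.exists_dist_modulus (show 0 < k / 2 by positivity)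
  obtain ⟨d₂, hd₂, hHd₂⟩ := hH.exists_dist_modulus (show 0 < k / 2 by positivity)
  set d₀ := min d₁ d₂ with hd₀
  have hd₀pos : 0 < d₀ := lt_min hd₁ hd₂
  obtain ⟨τ, hτ, hτ1, hτS, hτd, hτδ⟩ : ∃ τ > 0, τ < 1 ∧ τ < S / 2 ∧ τ < η * d₀ ∧
      (δ + 2 * lam + 1 + 4 * L) * τ < δ * S / 2 := by
    have hA : 0 < δ + 2 * lam + 1 + 4 * (L : ℝ) := by positivity
    obtain ⟨τ, hτ, h⟩ := exists_between (show 0 < min (min 1 (S / 2))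
      (min (η * d₀) (δ * S / 2 / (δ + 2 * lam + 1 + 4 * L))) by positivity)
    simp only [lt_min_iff, lt_div_iff₀ hA] at h
    exact ⟨τ, hτ, h.1.1, h.1.2, h.2.1, by linarith [h.2.2]⟩
  set κ : ℝ := τ ^ 2 / 2 with hκdef
  have hκ : 0 < κ := by positivity
  have hκτ : 2 * κ ≤ τ := by rw [hκdef]; nlinarith
  obtain ⟨e₁, he₁, hue⟩ := hu.exists_dist_modulus hκ
  obtain ⟨e₂, he₂, hve⟩ := hv.exists_dist_modulus hκ
  obtain ⟨e₃, he₃, hHe⟩ := hH.exists_dist_modulus hκ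
  obtain ⟨e₄, he₄, hGe⟩ := hG.exists_dist_modulus hκ
  set d : ℝ := min (min e₁ e₂) (min (min e₃ e₄) d₀) with hd
  have hdpos : 0 < d := by positivity
  have hde : ∀ {t : ℝ}, t < d → ((t < e₁ ∧ t < e₂) ∧ (t < e₃ ∧ t < e₄) ∧ t < d₀) := by
    intro t ht
    simpa only [hd, lt_min_iff] using ht
  obtain ⟨σ, hσ, hσsign⟩ : ∃ σ : ℝ, |σ| = 1 ∧ ((σ = -1 ∧ 0 ≤ u m) ∨ (σ = 1 ∧ u m ≤ 0)) := by
    rcases le_total 0 (u m) with h | h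
    · exact ⟨-1, by simp, Or.inl ⟨rfl, h⟩⟩
    · exact ⟨1, by simp, Or.inr ⟨rfl, h⟩⟩
  obtain ⟨ε, hε, x, hx, y, hy, hmax, hxyd, hlow, ht2⟩ :=
    exists_doubling_max hu hv hr hrmax hσ hdpos
      (fun a ha b hb hab => hve a ha b hb (hde hab).1.2)
  set t : ℝ := (x - y) / ε - σ with ht
  have htτ : |t| ≤ τ := abs_le_of_sq_le_sq (by rw [hκdef] at ht2; linarith) hτ.le
  have htτ' := abs_le.1 htτ
  have hxyt : x - y = ε * (t + σ) := by rw [ht]; field_simp; ring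
  have hsign : (x ≤ y ∧ 0 ≤ u m) ∨ (y ≤ x ∧ u m ≤ 0) := by
    rcases hσsign with ⟨h, h0⟩ | ⟨h, h0⟩
    · exact Or.inl ⟨by rw [h] at hxyt; nlinarith, h0⟩
    · exact Or.inr ⟨by rw [h] at hxyt; nlinarith, h0⟩
  have hvxy := abs_lt.1 (hve x hx y hy (hde hxyd).1.2)
  have huxy := abs_lt.1 (hue x hx y hy (hde hxyd).1.1)
  have hHxy := abs_lt.1 (hHe x hx y hy (hde hxyd).2.1.1)
  have hGxy := abs_lt.1 (hGe x hx y hy (hde hxyd).2.1.2)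
  have hηx := hηM x hx
  have hxI : x ∈ Ioo m M := by
    refine ⟨lt_of_le_of_ne hx.1 fun h => ?_, lt_of_le_of_ne hx.2 fun h => ?_⟩
    · have : u x = v x := by rw [← h, hbm]
      linarith
    · have : u x = v x := by rw [h, hbM]
      linarith
  have hyI : y ∈ Ioo m M := by
    refine ⟨lt_of_le_of_ne hy.1 fun h => ?_, lt_of_le_of_ne hy.2 fun h => ?_⟩
    · have : u y = v y := by rw [← h, hbm]
      linarith
    · have : u y = v y := by rw [h, hbM]
      linarith
  have hφ : HasDerivAt (fun z => u x - η * (z - x) + (((z - y) / ε - σ) ^ 2 - t ^ 2))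
      (2 * t / ε - η) x := by
    have h1 : HasDerivAt (fun z => (z - y) / ε - σ) (1 / ε) x :=
      (((hasDerivAt_id x).sub_const y).div_const ε).sub_const σ
    have h2 := ((((hasDerivAt_id x).sub_const x).const_mul η).const_sub (u x)).add
      ((h1.pow 2).sub_const (t ^ 2))
    refine h2.congr_deriv ?_
    rw [ht]; simp; ring
  have hψ : HasDerivAt (fun z => v y - (((x - z) / ε - σ) ^ 2 - t ^ 2)) (2 * t / ε) y := by
    have h1 : HasDerivAt (fun z => (x - z) / ε - σ) (-1 / ε) y :=
      (((hasDerivAt_id y).const_sub x).div_const ε).sub_const σ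
    have h2 := ((h1.pow 2).sub_const (t ^ 2)).const_sub (v y)
    refine h2.congr_deriv ?_
    rw [ht]; simp; ring
  have hvisc_u := hsub (fun z => u x - η * (z - x) + (((z - y) / ε - σ) ^ 2 - t ^ 2))
    (by fun_prop) x hxI (fun z hz => by
      have := hmax z hz y hy
      simp only [← ht]
      linarith) (by simp [← ht])
  have hvisc_v := hsup (fun z => v y - (((x - z) / ε - σ) ^ 2 - t ^ 2))
    (by fun_prop) y hyI (fun z hz => by
      have := hmax x hx z hz
      simp only [← ht]
      linarith) (by simp [← ht])
  rw [le_min_iff] at hvisc_v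
  obtain ⟨hpde_v, hobs_v⟩ := hvisc_v
  rcases min_le_iff.1 hvisc_u with hpde_u | hobs_u
  · simp only [Aop, hφ.deriv, hψ.deriv, ← ht, sub_self, mul_zero, sub_zero, add_zero]
      at hpde_u hpde_v
    have hI := setIntegral_sub_setIntegral_le μ hu hv hx hy hκ.le hSpos.le hS
      (fun a ha b hb hab => (hue a ha b hb (hde (hab.trans_lt hxyd)).1.1).le)
      (fun a ha b hb hab => (hve a ha b hb (hde (hab.trans_lt hxyd)).1.2).le) hbm hsign
    have hI' := mul_le_mul_of_nonneg_left hI hlam.le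
    have hcx := mul_le_mul_of_nonneg_right (hcC x hx) hη.le
    have hcp : (c y - c x) * (2 * t / ε) ≤ 4 * L * τ := by
      have h1 : |c y - c x| ≤ L * |x - y| := by
        have := hc_lip.dist_le_mul y hy x hx
        rwa [Real.dist_eq, Real.dist_eq, abs_sub_comm y x] at this
      have h2 : |x - y| ≤ ε * 2 := by
        rw [hxyt, abs_mul, abs_of_pos hε]
        gcongr
        exact (abs_add_le _ _).trans (by linarith)
      calc _ ≤ |(c y - c x) * (2 * t / ε)| := le_abs_self _
        _ = |c y - c x| * (2 * |t| / ε) := by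
            rw [abs_mul, abs_div, abs_mul, abs_of_pos hε, abs_two]
        _ ≤ (L * (ε * 2)) * (2 * τ / ε) := by
            gcongr
            exact h1.trans (by gcongr)
        _ = 4 * L * τ := by field_simp; ring
    have hηxM : η * x ≤ η * M := mul_le_mul_of_nonneg_left hx.2 hη.le
    have hgap : S - η * (M - m) - κ ≤ u x - v y := by linarith
    have hgap' := mul_le_mul_of_nonneg_left hgap (show 0 ≤ δ + lam by positivity)
    have hκA : (δ + 2 * lam + 1) * κ ≤ (δ + 2 * lam + 1) * τ := by gcongr; linarith
    linarith
  · obtain ⟨z, hz, hMz⟩ := exists_Mop_eq (k := k) hu hH hx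
    rw [hMz] at hobs_u
    have hzI : z ∈ Icc m M := ⟨hx.1.trans hz.1, hz.2⟩
    have hzx : d₀ ≤ z - x := by
      by_contra! h
      have hz0 : |z - x| < d₀ := by rwa [abs_of_nonneg (sub_nonneg.2 hz.1)]
      have h1 := abs_lt.1 (hud₁ z hzI x hx (hz0.trans_le (min_le_left _ _)))
      have h2 := abs_lt.1 (hHd₂ z hzI x hx (hz0.trans_le (min_le_right _ _)))
      linarith
    have hyz : y ≤ z := by
      have := (abs_lt.1 (hde hxyd).2.2).1
      linarith
    have hvz := le_Mop (k := k) hv hH hy ⟨hyz, hz.2⟩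
    have hηz := mul_le_mul_of_nonneg_left hzx hη.le
    linarith [hrmax z hzI]

/-- Theorem 4.2 (uniqueness): two bounded continuous viscosity solutions of
the HJB equation with the same boundary values coincide on `[m, M]`. -/
theorem uniqueness_viscosity_solution
    (m M lam δ k : ℝ) (hmM : m < M) (hlam : 0 < lam) (hδ : 0 < δ) (hk : 0 < k)
    (L : NNReal) (c : ℝ → ℝ)
    (hc_pos : ∀ r ∈ Icc m M, 0 < c r)
    (hc_anti : AntitoneOn c (Icc m M))
    (hc_lip : LipschitzOnWith L c (Icc m M))
    (μ : Measure ℝ) [IsProbabilityMeasure μ] (hμ : μ (Iio 0) = 0)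
    (G H : ℝ → ℝ)
    (hG_cont : ContinuousOn G (Icc m M))
    (hG_nonneg : ∀ r ∈ Icc m M, 0 ≤ G r)
    (hG_mono : MonotoneOn G (Icc m M))
    (hH_cont : ContinuousOn H (Icc m M))
    (hH_mono : StrictMonoOn H (Icc m M))
    (f g : ℝ → ℝ)
    (hf_bdd : ∃ C : ℝ, ∀ r ∈ Icc m M, |f r| ≤ C)
    (hg_bdd : ∃ C : ℝ, ∀ r ∈ Icc m M, |g r| ≤ C)
    (hf_cont : ContinuousOn f (Icc m M))
    (hg_cont : ContinuousOn g (Icc m M))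
    (hf_sub : IsViscositySubsolution m M lam δ k c μ G H f)
    (hf_sup : IsViscositySupersolution m M lam δ k c μ G H f)
    (hg_sub : IsViscositySubsolution m M lam δ k c μ G H g)
    (hg_sup : IsViscositySupersolution m M lam δ k c μ G H g)
    (hbm : f m = g m) (hbM : f M = g M) :
    ∀ r ∈ Icc m M, f r = g r := by
  exact fun r hr => le_antisymm
    (viscosity_comparison hlam hδ hk hc_lip μ hG_cont hH_cont hf_cont hg_cont hf_sub hg_sup
      hbm hbM r hr)
    (viscosity_comparison hlam hδ hk hc_lip μ hG_cont hH_cont hg_cont hf_cont hg_sub hf_sup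
      hbm.symm hbM.symm r hr)
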